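/- If non(𝒩) > non(ℳ) or cov*(ℳ) ≥ cof(ℳ), then there is no translation invariant Borel hull operation on 𝒩 with respect to 𝒩. -/

import Mathlib

open MeasureTheory Cardinal Pointwise

/-- `non(ℐ)`: the least cardinality of a set not in the ideal `I`. -/
noncomputable def idealNon {X : Type*} (I : Set (Set X)) : Cardinal :=
  sInf {c : Cardinal | ∃ A : Set X, A ∉ I ∧ #A = c}

/-- `cof(ℐ)`: the least cardinality of a family `F ⊆ I` cofinal in `I` under inclusion. -/
noncomputable def idealCof {X : Type*} (I : Set (Set X)) : Cardinal :=
  sInf {c : Cardinal | ∃ F : Set (Set X), F ⊆ I ∧ (∀ A ∈ I, ∃ B ∈ F, A ⊆ B) ∧ #F = c}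

/-- `cov*(ℐ)`: the least cardinality of a set `A` such that `A + B = ℝⁿ` for some `B ∈ I`. -/
noncomputable def idealCovStar {X : Type*} [Add X] (I : Set (Set X)) : Cardinal :=
  sInf {c : Cardinal | ∃ A : Set X, (∃ B ∈ I, A + B = Set.univ) ∧ #A = c}

/-- A nonmeagre Borel set contains almost all points of a nonempty open set. -/
theorem MeasurableSet.exists_isOpen_isMeagre_diff {E : Type*} [TopologicalSpace E] [MeasurableSpace E] [BorelSpace E]
    {B : Set E} (hB : MeasurableSet B) (hBm : ¬ IsMeagre B) :
    ∃ U : Set E, IsOpen U ∧ U.Nonempty ∧ IsMeagre (U \ B) := by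
  obtain ⟨U, hU, hBU⟩ := hB.residualEq_isOpen
  rw [Filter.eventuallyEq_set] at hBU
  refine ⟨U, hU, Set.nonempty_iff_ne_empty.2 ?_, ?_⟩
  · rintro rfl
    refine hBm ?_
    rw [IsMeagre]
    filter_upwards [hBU] with x hx hxB using hx.1 hxB
  · rw [IsMeagre]
    filter_upwards [hBU] with x hx hxU using hxU.2 (hx.2 hxU.1)

section NonmeagreSubgroup

variable {E : Type*} [AddCommGroup E] [TopologicalSpace E] [IsTopologicalAddGroup E]

/-- Translates of meagre sets are meagre. -/
theorem IsMeagre.preimage_add_right {s : Set E} (hs : IsMeagre s) (g : E) :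
    IsMeagre ((· + g) ⁻¹' s) :=
  hs.preimage_of_isOpenMap (Homeomorph.addRight g).continuous (Homeomorph.addRight g).isOpenMap

theorem IsMeagre.countable_add {s t : Set E} (hs : s.Countable) (ht : IsMeagre t) :
    IsMeagre (s + t) := by
  refine (isMeagre_biUnion hs fun a _ => ht.preimage_add_right (-a)).mono ?_
  rintro _ ⟨a, ha, b, hb, rfl⟩
  exact Set.mem_biUnion ha (by simpa using hb)

/-- A nonmeagre subgroup of a connected group is dense. -/
theorem AddSubgroup.dense_of_not_isMeagre [ConnectedSpace E] (G : AddSubgroup E)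
    (hG : ¬ IsMeagre (G : Set E)) : Dense (G : Set E) := by
  have hne : (interior (_root_.closure (G : Set E))).Nonempty := by
    by_contra h
    exact hG (IsNowhereDense.isMeagre (Set.not_nonempty_iff_eq_empty.1 h))
  obtain ⟨x, hx⟩ := hne
  have hopen : IsOpen (G.topologicalClosure : Set E) :=
    G.topologicalClosure.isOpen_of_mem_nhds (mem_interior_iff_mem_nhds.1 hx)
  have huniv : (G.topologicalClosure : Set E) = Set.univ :=
    IsClopen.eq_univ ⟨G.isClosed_topologicalClosure, hopen⟩ ⟨0, zero_mem _⟩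
  exact dense_iff_closure_eq.2 huniv

/-- A Borel set that contains a nonmeagre subgroup and is invariant under it is everything. -/
theorem MeasurableSet.eq_univ_of_invariant [ConnectedSpace E] [BaireSpace E]
    [MeasurableSpace E] [BorelSpace E] {B : Set E} (hB : MeasurableSet B) (G : AddSubgroup E)
    (hG : ¬ IsMeagre (G : Set E)) (hGB : (G : Set E) ⊆ B)
    (hinv : ∀ g ∈ G, ∀ x ∈ B, x + g ∈ B) : B = Set.univ := by
  by_contra hne
  obtain ⟨c, hc⟩ := (Set.ne_univ_iff_exists_notMem B).1 hne
  have hGC : ∀ g ∈ G, c + g ∉ B := fun g hg h => hc (by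
    simpa using hinv (-g) (neg_mem hg) _ h)
  have hCm : ¬ IsMeagre Bᶜ := fun h => hG <| (h.preimage_add_right c).mono fun g hg => by
    simpa [add_comm] using hGC g hg
  obtain ⟨U, hU, ⟨u, hu⟩, hUB⟩ := hB.exists_isOpen_isMeagre_diff fun h => hG (h.mono hGB)
  obtain ⟨V, hV, ⟨v, hv⟩, hVB⟩ := hB.compl.exists_isOpen_isMeagre_diff hCm
  have hW : IsOpen ((fun g => u + g) ⁻¹' V) := hV.preimage (by fun_prop)
  obtain ⟨g, hgV, hgG⟩ := (G.dense_of_not_isMeagre hG).inter_open_nonempty _ hW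
    ⟨v - u, by simpa using hv⟩
  refine not_isMeagre_of_isOpen (hU.inter (hV.preimage (continuous_add_const g))) ⟨u, hu, hgV⟩
    ((hUB.union (hVB.preimage_add_right g)).mono ?_)
  rintro x ⟨hxU, hxV⟩
  by_cases hx : x ∈ B
  · exact Or.inr ⟨hxV, fun h => h (hinv g hgG x hx)⟩
  · exact Or.inl ⟨hxU, hx⟩

end NonmeagreSubgroup

theorem Submodule.mk_span_rat_le {E : Type} [AddCommGroup E] [Module ℚ E] (s : Set E) :
    #(Submodule.span ℚ s) ≤ max #s ℵ₀ := by
  rw [← Subtype.range_coe (s := s), ← Finsupp.range_linearCombination, Subtype.range_coe]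
  refine mk_range_le.trans ?_
  rcases isEmpty_or_nonempty s with h | h
  · exact (Cardinal.mk_le_aleph0 (α := s →₀ ℚ)).trans (le_max_right _ _)
  · simp

/-- If `cof(ℳ) ≤ cov*(ℳ)`, some nonmeagre rational subspace avoids a prescribed meagre set,
except possibly at the origin. -/
theorem exists_submodule_not_isMeagre_of_idealCof_le {E : Type} [AddCommGroup E] [Module ℚ E]
    [TopologicalSpace E] [IsTopologicalAddGroup E] [ContinuousConstSMul ℚ E] [BaireSpace E]
    (h : idealCof {A : Set E | IsMeagre A} ≤ idealCovStar {A : Set E | IsMeagre A})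
    {M : Set E} (hM : IsMeagre M) :
    ∃ G : Submodule ℚ E, ¬ IsMeagre (G : Set E) ∧ ∀ x ∈ G, x ≠ 0 → x ∉ M := by
  obtain ⟨ι, C, hCI, hC, hCc⟩ : ∃ (ι : Type) (C : ι → Set E), (∀ i, IsMeagre (C i)) ∧
      (∀ A, IsMeagre A → ∃ i, A ⊆ C i) ∧ #ι = idealCof {A : Set E | IsMeagre A} := by
    obtain ⟨F, hFI, hF, hFc⟩ : idealCof {A : Set E | IsMeagre A} ∈
        {c : Cardinal | ∃ F : Set (Set E), F ⊆ {A : Set E | IsMeagre A} ∧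
          (∀ A ∈ {A : Set E | IsMeagre A}, ∃ B ∈ F, A ⊆ B) ∧ #F = c} :=
      csInf_mem ⟨_, _, subset_rfl, fun A hA => ⟨A, hA, subset_rfl⟩, rfl⟩
    refine ⟨F, Subtype.val, fun i => hFI i.2, fun A hA => ?_, hFc⟩
    obtain ⟨B, hB, hAB⟩ := hF A hA
    exact ⟨⟨B, hB⟩, hAB⟩
  obtain ⟨_, _, hr⟩ := exists_ord_eq_type_lt ι
  have havoid : ∀ A B : Set E, #A < idealCovStar {A : Set E | IsMeagre A} → IsMeagre B →
      ∃ x, x ∉ A + B := by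
    intro A B hA hB
    by_contra! hx
    exact notMem_of_lt_csInf' hA ⟨A, ⟨B, hB, Set.eq_univ_of_forall hx⟩, rfl⟩
  have havoid' : ∀ A B : Set E, A.Countable → IsMeagre B → ∃ x, x ∉ A + B := by
    intro A B hA hB
    by_contra! hx
    refine not_isMeagre_of_isOpen (X := E) isOpen_univ ⟨0, trivial⟩ ?_
    exact Set.eq_univ_of_forall hx ▸ IsMeagre.countable_add hA hB
  let M' : Set E := ⋃ q : {q : ℚ // q ≠ 0}, (fun x => (q : ℚ) • x) ⁻¹' M
  have hM' : IsMeagre M' := isMeagre_iUnion fun q =>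
    hM.preimage_of_isOpenMap (continuous_const_smul _) (isOpenMap_smul₀ q.2)
  have hstep : ∀ (a : ι) (f : ∀ b : ι, b < a → E), ∃ x,
      x ∉ (Submodule.span ℚ (Set.range fun b : Set.Iio a => f b b.2) : Set E) + (M' ∪ C a) := by
    intro a f
    have hmeag : IsMeagre (M' ∪ C a) := hM'.union (hCI a)
    have hcard := (Submodule.mk_span_rat_le (Set.range fun b : Set.Iio a => f b b.2)).trans
      (max_le_max_right ℵ₀ mk_range_le)
    rcases le_total #(Set.Iio a) ℵ₀ with hle | hle
    · rw [max_eq_right hle] at hcard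
      exact havoid' _ _ (Cardinal.le_aleph0_iff_set_countable.1 hcard) hmeag
    · rw [max_eq_left hle] at hcard
      refine havoid _ _ (hcard.trans_lt ?_) hmeag
      exact (Cardinal.mk_Iio_lt a hr).trans_le (hCc.trans_le h)
  choose next hnext using hstep
  let g : ι → E := wellFounded_lt.fix next
  have hg : ∀ a, g a ∉ (Submodule.span ℚ (g '' Set.Iio a) : Set E) + (M' ∪ C a) := by
    intro a
    have := hnext a fun b _ => g b
    rw [Set.image_eq_range]
    have heq : g a = next a fun b _ => g b := wellFounded_lt.fix_eq next a
    rwa [heq]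
  refine ⟨Submodule.span ℚ (Set.range g), fun hmeag => ?_, fun x hx hx0 hxM => ?_⟩
  · obtain ⟨i, hsub⟩ := hC _ hmeag
    refine hg i ⟨0, zero_mem _, g i, Or.inr ?_, zero_add _⟩
    exact hsub (Submodule.subset_span ⟨_, rfl⟩)
  · obtain ⟨f, rfl⟩ := (Finsupp.mem_span_range_iff_exists_finsupp).1 hx
    have hne : f.support.Nonempty := by
      rw [Finsupp.support_nonempty_iff]
      rintro rfl
      simp at hx0
    let a := f.support.max' hne
    have ha : f a ≠ 0 := Finsupp.mem_support_iff.1 (f.support.max'_mem hne)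
    let y := ∑ b ∈ f.support.erase a, f b • g b
    have hy : y ∈ Submodule.span ℚ (g '' Set.Iio a) := by
      refine Submodule.sum_mem _ fun b hb => Submodule.smul_mem _ _ (Submodule.subset_span ?_)
      exact ⟨b, f.support.lt_max'_of_mem_erase_max' hne hb, rfl⟩
    have hsum : f.sum (fun i c => c • g i) = f a • g a + y :=
      (Finset.add_sum_erase _ _ (f.support.max'_mem hne)).symm
    refine hg a ⟨-((f a)⁻¹ • y), neg_mem (Submodule.smul_mem _ _ hy),
      (f a)⁻¹ • f.sum (fun i c => c • g i), Or.inl ?_, ?_⟩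
    · refine Set.mem_iUnion.2 ⟨⟨f a, ha⟩, ?_⟩
      simpa [smul_smul, ha] using hxM
    · simp [hsum, smul_smul, ha]

/-- There is a comeagre Lebesgue null set in `ℝⁿ` for `n ≥ 1`. -/
theorem exists_isMeagre_volume_compl_eq_zero (n : ℕ) (hn : 1 ≤ n) :
    ∃ M : Set (Fin n → ℝ), IsMeagre M ∧ volume Mᶜ = 0 := by
  let i : Fin n := ⟨0, hn⟩
  refine ⟨Function.eval i ⁻¹' {x | ¬ Liouville x}, ?_, ?_⟩
  · refine IsMeagre.preimage_of_isOpenMap (continuous_apply i) (isOpenMap_eval i) ?_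
    rw [IsMeagre]
    filter_upwards [eventually_residual_liouville] with x hx h using h hx
  · exact Measure.tendsto_eval_ae_ae (μ := fun _ => volume) ae_not_liouville

/-- If `non(𝒩) > non(ℳ)`, there is a nonmeagre null rational subspace. -/
theorem exists_submodule_not_isMeagre_of_idealNon_lt (n : ℕ)
    (h : idealNon {A : Set (Fin n → ℝ) | IsMeagre A} <
      idealNon {A : Set (Fin n → ℝ) | volume A = 0}) (hn : 1 ≤ n) :
    ∃ G : Submodule ℚ (Fin n → ℝ), ¬ IsMeagre (G : Set (Fin n → ℝ)) ∧
      volume (G : Set (Fin n → ℝ)) = 0 := by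
  obtain ⟨A, hA, hAc⟩ : idealNon {A : Set (Fin n → ℝ) | IsMeagre A} ∈
      {c : Cardinal | ∃ A : Set (Fin n → ℝ), A ∉ {A : Set (Fin n → ℝ) | IsMeagre A} ∧ #A = c} :=
    csInf_mem ⟨_, Set.univ, not_isMeagre_of_isOpen isOpen_univ ⟨0, trivial⟩, rfl⟩
  refine ⟨Submodule.span ℚ A, fun hm => hA (hm.mono Submodule.subset_span), ?_⟩
  have : Nonempty (Fin n) := ⟨⟨0, hn⟩⟩
  have hcard := Submodule.mk_span_rat_le A
  rcases le_total #A ℵ₀ with hle | hle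
  · rw [max_eq_right hle] at hcard
    exact (Cardinal.le_aleph0_iff_set_countable.1 hcard).measure_zero _
  · rw [max_eq_left hle] at hcard
    by_contra hv
    exact notMem_of_lt_csInf' (hcard.trans_lt (hAc.trans_lt h)) ⟨_, hv, rfl⟩

/-- If `non(𝒩) > non(ℳ)` or `cov*(ℳ) ≥ cof(ℳ)`, then there is no translation invariant
Borel hull operation on `𝒩` with respect to `𝒩`. -/
theorem no_translation_invariant_hull_on_null_of_cardinals (n : ℕ) (hn : 1 ≤ n)
    (h : idealNon {A : Set (Fin n → ℝ) | volume A = 0} >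
        idealNon {A : Set (Fin n → ℝ) | IsMeagre A} ∨
      idealCovStar {A : Set (Fin n → ℝ) | IsMeagre A} ≥
        idealCof {A : Set (Fin n → ℝ) | IsMeagre A}) :
    ¬ ∃ ψ : Set (Fin n → ℝ) → Set (Fin n → ℝ),
      (∀ A : Set (Fin n → ℝ), volume A = 0 →
        MeasurableSet (ψ A) ∧ A ⊆ ψ A ∧ volume (ψ A \ A) = 0) ∧
      (∀ A : Set (Fin n → ℝ), volume A = 0 → ∀ x : Fin n → ℝ,
        ψ ((· + x) '' A) = (· + x) '' ψ A) := by
  rintro ⟨ψ, hψ, hinv⟩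
  have : Nonempty (Fin n) := ⟨⟨0, hn⟩⟩
  obtain ⟨G, hGm, hG0⟩ : ∃ G : Submodule ℚ (Fin n → ℝ), ¬ IsMeagre (G : Set (Fin n → ℝ)) ∧
      volume (G : Set (Fin n → ℝ)) = 0 := by
    rcases h with h | h
    · exact exists_submodule_not_isMeagre_of_idealNon_lt n h hn
    · obtain ⟨M, hM, hM0⟩ := exists_isMeagre_volume_compl_eq_zero n hn
      obtain ⟨G, hGm, hG⟩ := exists_submodule_not_isMeagre_of_idealCof_le h hM
      refine ⟨G, hGm, measure_mono_null (t := {0} ∪ Mᶜ) (fun x hx => ?_)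
        (measure_union_null (measure_singleton 0) hM0)⟩
      exact or_iff_not_imp_left.2 (hG x hx)
  obtain ⟨hmeas, hsub, hdiff⟩ := hψ G hG0
  have huniv : ψ G = Set.univ := by
    refine hmeas.eq_univ_of_invariant G.toAddSubgroup hGm hsub fun g hg x hx => ?_
    have hGg : (· + g) '' (G : Set (Fin n → ℝ)) = G := by
      ext y
      refine ⟨?_, fun hy => ⟨y - g, G.sub_mem hy hg, sub_add_cancel y g⟩⟩
      rintro ⟨z, hz, rfl⟩
      exact G.add_mem hz hg
    have := hinv G hG0 g
    rw [hGg] at this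
    rw [this]
    exact ⟨x, hx, rfl⟩
  have h0 : volume (ψ G) = 0 :=
    measure_mono_null (t := (ψ G \ G) ∪ G) (by simp) (measure_union_null hdiff hG0)
  rw [huniv] at h0
  exact isOpen_univ.measure_ne_zero volume Set.univ_nonempty h0
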